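/- arXiv:2601.01111 — 13 statements merged into one kernel-verified Lean document; each statement's English description precedes it below -/
import Mathlib

section
/- Let {φ_i}_{i=1}^M be nonzero vectors in ℝ^N. If the family of hyperplanes {φ_i^⊥}_{i=1}^M does norm retrieval in ℝ^N, then either {φ_i}_{i=1}^M spans ℝ^N or {φ_i}_{i=1}^M is linearly dependent. -/
open Submodule
open scoped RealInnerProductSpace

theorem LinearIndependent.exists_inner_eq {E ι : Type*} [NormedAddCommGroup E]
    [InnerProductSpace ℝ E] [FiniteDimensional ℝ E] {v : ι → E} (hv : LinearIndependent ℝ v)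
    (c : ι → ℝ) : ∃ w : E, ∀ i, ⟪v i, w⟫ = c i := by
  obtain ⟨f, hf⟩ := LinearMap.exists_extend ((Module.Basis.span hv).constr ℝ c)
  refine ⟨(InnerProductSpace.toDual ℝ E).symm f.toContinuousLinearMap, fun i => ?_⟩
  rw [real_inner_comm, InnerProductSpace.toDual_symm_apply]
  have h := LinearMap.congr_fun hf (Module.Basis.span hv i)
  rw [Module.Basis.constr_basis] at h
  simpa [Module.Basis.span_apply] using h

theorem Submodule.norm_sq_orthogonalProjectionOnto_orthogonal_singleton {E : Type*}
    [NormedAddCommGroup E] [InnerProductSpace ℝ E] (u x : E) :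
    ‖orthogonalProjectionOnto (ℝ ∙ u)ᗮ x‖ ^ 2 = ‖x‖ ^ 2 - (⟪u, x⟫ / ‖u‖) ^ 2 := by
  have h := Submodule.norm_sq_eq_add_norm_sq_projection x (ℝ ∙ u)
  have h2 : ‖orthogonalProjectionOnto (ℝ ∙ u) x‖ = |⟪u, x⟫ / ‖u‖| := by
    rw [Submodule.coe_norm, ← Submodule.starProjection_apply, Submodule.starProjection_singleton,
      norm_smul]
    rcases eq_or_ne ‖u‖ 0 with hu | hu
    · simp [hu]
    · simp only [Real.norm_eq_abs, abs_div, RCLike.ofReal_real_eq_id, id_eq, abs_pow, abs_norm]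
      field_simp
  rw [h2, sq_abs] at h
  linarith

/-- If the hyperplanes `(φ i)ᗮ` do norm retrieval in `ℝ^N` and all `φ i` are nonzero,
then either the `φ i` span `ℝ^N` or they are linearly dependent. -/
theorem stmt_0 (N M : ℕ) (φ : Fin M → EuclideanSpace ℝ (Fin N))
    (hφ : ∀ i, φ i ≠ 0)
    (hNR : ∀ x y : EuclideanSpace ℝ (Fin N),
      (∀ i, ‖orthogonalProjection (ℝ ∙ φ i)ᗮ x‖ = ‖orthogonalProjection (ℝ ∙ φ i)ᗮ y‖) →
      ‖x‖ = ‖y‖) :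
    Submodule.span ℝ (Set.range φ) = ⊤ ∨ ¬ LinearIndependent ℝ φ := by
  by_contra! ⟨hspan, hli⟩
  obtain ⟨z₀, hz₀, hz₀_ne⟩ := Submodule.exists_mem_ne_zero_of_ne_bot
    (mt Submodule.orthogonal_eq_bot_iff.mp hspan)
  obtain ⟨z, hz, hz_norm⟩ : ∃ z ∈ (Submodule.span ℝ (Set.range φ))ᗮ, ‖z‖ = 1 :=
    ⟨‖z₀‖⁻¹ • z₀, Submodule.smul_mem _ _ hz₀, norm_smul_inv_norm hz₀_ne⟩
  have hφz (i) : ⟪φ i, z⟫ = 0 :=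
    (Submodule.mem_orthogonal _ _).mp hz _ (Submodule.subset_span ⟨i, rfl⟩)
  obtain ⟨v, hv⟩ := hli.exists_inner_eq fun i => ‖φ i‖
  obtain ⟨w, hw, hwz⟩ : ∃ w, (∀ i, ⟪φ i, w⟫ = ‖φ i‖) ∧ ⟪w, z⟫ = 0 := by
    refine ⟨v - ⟪v, z⟫ • z, fun i => ?_, ?_⟩
    · simp [inner_sub_right, inner_smul_right, hv, hφz]
    · simp [inner_sub_left, inner_smul_left, hz_norm]
  have hnorm : ‖w + z‖ ^ 2 = ‖w‖ ^ 2 + 1 := by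
    rw [norm_add_sq_real, hwz, hz_norm]
    ring
  have hscale : ‖‖w‖ • z‖ = ‖w‖ := by simp [norm_smul, hz_norm]
  have hproj (i) : ‖orthogonalProjectionOnto (ℝ ∙ φ i)ᗮ (‖w‖ • z)‖ =
      ‖orthogonalProjectionOnto (ℝ ∙ φ i)ᗮ (w + z)‖ := by
    have hi : ‖φ i‖ ≠ 0 := norm_ne_zero_iff.mpr (hφ i)
    rw [← sq_eq_sq₀ (norm_nonneg _) (norm_nonneg _),
      Submodule.norm_sq_orthogonalProjectionOnto_orthogonal_singleton,
      Submodule.norm_sq_orthogonalProjectionOnto_orthogonal_singleton, hnorm, hscale,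
      inner_smul_right, inner_add_right, hφz, hw]
    simp [hi]
  rw [← hNR _ _ hproj, hscale] at hnorm
  linarith
end

section
/- Suppose {φ_i}_{i=1}^N is a linearly independent set of unit vectors in ℝ^N such that the hyperplanes {φ_i^⊥}_{i=1}^N do norm retrieval in ℝ^N. If x, y ∈ ℝ^N satisfy ⟨x, φ_i⟩ = ±1 and ⟨y, φ_i⟩ = ±1 for all i ∈ [N] (i.e., |⟨x, φ_i⟩| = 1 and |⟨y, φ_i⟩| = 1 for every i), then ‖x‖ = ‖y‖. -/
open Submodule
open scoped RealInnerProductSpace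

lemma norm_sq_orthogonalProjectionOnto_orthogonal_span_singleton {E : Type*}
    [NormedAddCommGroup E] [InnerProductSpace ℝ E] {v : E} (hv : ‖v‖ = 1) (x : E) :
    ‖orthogonalProjectionOnto (ℝ ∙ v)ᗮ x‖ ^ 2 = ‖x‖ ^ 2 - ⟪x, v⟫ ^ 2 := by
  have h := norm_sq_eq_add_norm_sq_projection x (ℝ ∙ v)
  have hp : ‖orthogonalProjectionOnto (ℝ ∙ v) x‖ = |⟪x, v⟫| := by
    rw [← norm_coe, ← starProjection_apply, starProjection_unit_singleton ℝ hv, norm_smul, hv,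
      mul_one, Real.norm_eq_abs, real_inner_comm]
  rw [hp, sq_abs] at h
  linarith

/-- If `{φ i}` is a linearly independent family of `N` unit vectors in `ℝ^N` whose
hyperplanes do norm retrieval, and `x, y` satisfy `|⟪x, φ i⟫| = |⟪y, φ i⟫| = 1` for all `i`,
then `‖x‖ = ‖y‖`. -/
theorem stmt_1 (N : ℕ) (φ : Fin N → EuclideanSpace ℝ (Fin N))
    (hind : LinearIndependent ℝ φ) (hunit : ∀ i, ‖φ i‖ = 1)
    (hNR : ∀ x y : EuclideanSpace ℝ (Fin N),
      (∀ i, ‖orthogonalProjection (ℝ ∙ φ i)ᗮ x‖ = ‖orthogonalProjection (ℝ ∙ φ i)ᗮ y‖) →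
      ‖x‖ = ‖y‖)
    (x y : EuclideanSpace ℝ (Fin N))
    (hx : ∀ i, |⟪x, φ i⟫| = 1) (hy : ∀ i, |⟪y, φ i⟫| = 1) :
    ‖x‖ = ‖y‖ := by
  rcases isEmpty_or_nonempty (Fin N) with hN | ⟨⟨i₀⟩⟩
  · rw [Subsingleton.elim x y]
  have one_le_sq {z : EuclideanSpace ℝ (Fin N)} (hz : ∀ i, |⟪z, φ i⟫| = 1) : 1 ≤ ‖z‖ ^ 2 := by
    have h := abs_real_inner_le_norm z (φ i₀)
    rw [hz, hunit, mul_one] at h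
    exact one_le_pow₀ h
  have hproj {z : EuclideanSpace ℝ (Fin N)} (hz : ∀ i, |⟪z, φ i⟫| = 1) (i : Fin N) :
      ‖orthogonalProjectionOnto (ℝ ∙ φ i)ᗮ z‖ ^ 2 = ‖z‖ ^ 2 - 1 := by
    rw [norm_sq_orthogonalProjectionOnto_orthogonal_span_singleton (hunit i), ← sq_abs ⟪z, φ i⟫, hz,
      one_pow]
  -- Rescale `x` and `y` so that all their projections have the same norm.
  have ha := Real.sq_sqrt (sub_nonneg.2 (one_le_sq hy))
  have hb := Real.sq_sqrt (sub_nonneg.2 (one_le_sq hx))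
  have key := hNR (√(‖y‖ ^ 2 - 1) • x) (√(‖x‖ ^ 2 - 1) • y) fun i => by
    unfold orthogonalProjection
    rw [← sq_eq_sq₀ (norm_nonneg _) (norm_nonneg _), map_smul, map_smul, norm_smul, norm_smul,
      mul_pow, mul_pow, hproj hx, hproj hy, Real.norm_eq_abs, Real.norm_eq_abs, sq_abs, sq_abs,
      ha, hb, mul_comm]
  rw [← sq_eq_sq₀ (norm_nonneg _) (norm_nonneg _), norm_smul, norm_smul, mul_pow, mul_pow,
    Real.norm_eq_abs, Real.norm_eq_abs, sq_abs, sq_abs, ha, hb] at key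
  rw [← sq_eq_sq₀ (norm_nonneg _) (norm_nonneg _)]
  linarith
end

section
/- If {φ_i}_{i=1}^N is a linearly independent set of unit vectors in ℝ^N such that the hyperplanes {φ_i^⊥}_{i=1}^N do norm retrieval in ℝ^N, then {φ_i}_{i=1}^N is an orthonormal basis for ℝ^N, i.e., ⟨φ_i, φ_j⟩ = 0 for all i ≠ j. -/
open Submodule
open scoped RealInnerProductSpace

section

variable {E : Type*} [NormedAddCommGroup E] [InnerProductSpace ℝ E]

theorem norm_sq_orthogonalProjectionOnto_span_singleton_orthogonal {e : E} (he : ‖e‖ = 1)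
    (x : E) :
    ‖orthogonalProjectionOnto (ℝ ∙ e)ᗮ x‖ ^ 2 = ‖x‖ ^ 2 - ⟪e, x⟫ ^ 2 := by
  have h := norm_sq_eq_add_norm_sq_projection x (ℝ ∙ e)
  have h' : ‖orthogonalProjectionOnto (ℝ ∙ e) x‖ = |⟪e, x⟫| := by
    rw [← Submodule.norm_coe, ← starProjection_apply, starProjection_unit_singleton ℝ he, norm_smul,
      he, mul_one, Real.norm_eq_abs]
  rw [h', sq_abs] at h
  linarith

/-- Polarized form of norm retrieval by hyperplanes: if `⟪u, v⟫` agrees with every product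
`⟪φ i, u⟫ * ⟪φ i, v⟫`, then it vanishes. -/
theorem inner_eq_zero_of_hyperplane_norm_retrieval {ι : Type*} {φ : ι → E}
    (hunit : ∀ i, ‖φ i‖ = 1)
    (hNR : ∀ x y : E,
      (∀ i, ‖orthogonalProjectionOnto (ℝ ∙ φ i)ᗮ x‖ = ‖orthogonalProjectionOnto (ℝ ∙ φ i)ᗮ y‖) →
      ‖x‖ = ‖y‖)
    {u v : E} (huv : ∀ i, ⟪φ i, u⟫ * ⟪φ i, v⟫ = ⟪u, v⟫) : ⟪u, v⟫ = 0 := by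
  have key : ‖u + v‖ = ‖u - v‖ := by
    refine hNR _ _ fun i => ?_
    rw [← sq_eq_sq₀ (norm_nonneg _) (norm_nonneg _),
      norm_sq_orthogonalProjectionOnto_span_singleton_orthogonal (hunit i),
      norm_sq_orthogonalProjectionOnto_span_singleton_orthogonal (hunit i),
      norm_add_sq_real, norm_sub_sq_real, inner_add_right, inner_sub_right]
    linear_combination (-4) * huv i
  have h : ‖u + v‖ ^ 2 = ‖u - v‖ ^ 2 := by rw [key]
  rw [norm_add_sq_real, norm_sub_sq_real] at h
  linarith

theorem exists_one_le_add_inv_eq {w : ℝ} (hw : 2 ≤ w) : ∃ t : ℝ, 1 ≤ t ∧ t + t⁻¹ = w := by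
  have hs := Real.sq_sqrt (show 0 ≤ w ^ 2 - 4 by nlinarith)
  have hs0 := Real.sqrt_nonneg (w ^ 2 - 4)
  refine ⟨(w + √(w ^ 2 - 4)) / 2, by linarith, ?_⟩
  have ht : w + √(w ^ 2 - 4) ≠ 0 := by positivity
  field_simp
  linear_combination hs

/-- The family biorthogonal to a basis whose hyperplanes do norm retrieval is orthogonal. -/
theorem inner_eq_zero_of_biorthogonal_of_hyperplane_norm_retrieval {ι : Type*} [Fintype ι]
    [DecidableEq ι] {φ ψ : ι → E} (hunit : ∀ i, ‖φ i‖ = 1)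
    (hNR : ∀ x y : E,
      (∀ i, ‖orthogonalProjectionOnto (ℝ ∙ φ i)ᗮ x‖ = ‖orthogonalProjectionOnto (ℝ ∙ φ i)ᗮ y‖) →
      ‖x‖ = ‖y‖)
    (hψ : ∀ i j, ⟪φ i, ψ j⟫ = if i = j then 1 else 0) {i j : ι} (hij : i ≠ j) :
    ⟪ψ i, ψ j⟫ = 0 := by
  by_contra hne
  set a : ι → ℝ := fun k => if 0 < ⟪ψ i, ψ k⟫ then -1 else 1 with ha
  have ha_sq (k : ι) : a k * a k = 1 := by simp only [ha]; split_ifs <;> norm_num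
  have ha_mul (k : ι) : a k * ⟪ψ i, ψ k⟫ = -|⟪ψ i, ψ k⟫| := by
    simp only [ha]
    split_ifs with h
    · rw [abs_of_pos h]; ring
    · rw [abs_of_nonpos (not_lt.mp h)]; ring
  set w : E := ∑ k ∈ Finset.univ.erase i, a k • ψ k with hw
  have hφw (k : ι) : ⟪φ k, w⟫ = if k = i then 0 else a k := by
    simp only [hw, inner_sum, inner_smul_right, hψ, mul_ite, mul_one, mul_zero,
      Finset.sum_ite_eq, Finset.mem_erase, Finset.mem_univ, and_true]
    split_ifs <;> simp_all
  have hs : ⟪ψ i, w⟫ < 0 := by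
    simp only [hw, inner_sum, inner_smul_right, ha_mul, Finset.sum_neg_distrib, neg_lt_zero]
    exact Finset.sum_pos' (fun _ _ => abs_nonneg _) ⟨j, by simp [hij.symm], abs_pos.mpr hne⟩
  have hexp (t : ℝ) : ⟪w + t • ψ i, w + t⁻¹ • ψ i⟫ =
      ‖w‖ ^ 2 + (t + t⁻¹) * ⟪ψ i, w⟫ + t * t⁻¹ * ‖ψ i‖ ^ 2 := by
    simp only [inner_add_left, inner_add_right, inner_smul_left, inner_smul_right,
      real_inner_self_eq_norm_sq, real_inner_comm (ψ i) w, RCLike.conj_to_real]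
    ring
  have hge : 1 ≤ ‖w‖ ^ 2 + 2 * ⟪ψ i, w⟫ + ‖ψ i‖ ^ 2 := by
    have h1 : ⟪φ i, w + ψ i⟫ = 1 := by simp [inner_add_right, hφw, hψ]
    have h2 := real_inner_le_norm (φ i) (w + ψ i)
    rw [h1, hunit, one_mul] at h2
    have h3 := norm_add_sq_real w (ψ i)
    rw [real_inner_comm] at h3
    nlinarith
  obtain ⟨t, ht, hteq⟩ := exists_one_le_add_inv_eq
    (w := (1 - ‖w‖ ^ 2 - ‖ψ i‖ ^ 2) / ⟪ψ i, w⟫) (by rw [le_div_iff_of_neg hs]; linarith)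
  have ht0 : t ≠ 0 := by positivity
  have hone : ⟪w + t • ψ i, w + t⁻¹ • ψ i⟫ = 1 := by
    rw [hexp, hteq, div_mul_cancel₀ _ hs.ne, mul_inv_cancel₀ ht0]
    ring
  have hzero := inner_eq_zero_of_hyperplane_norm_retrieval hunit hNR
    (u := w + t • ψ i) (v := w + t⁻¹ • ψ i) fun k => by
      rw [hone]
      by_cases hk : k = i
      · simp [inner_add_right, inner_smul_right, hφw, hψ, hk, ht0]
      · simp [inner_add_right, inner_smul_right, hφw, hψ, hk, ha_sq]
  exact one_ne_zero (hone.symm.trans hzero)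

theorem Module.Basis.inner_eq_zero_of_hyperplane_norm_retrieval {ι : Type*} [Fintype ι]
    [FiniteDimensional ℝ E] (b : Module.Basis ι ℝ E) (hunit : ∀ i, ‖b i‖ = 1)
    (hNR : ∀ x y : E,
      (∀ i, ‖orthogonalProjectionOnto (ℝ ∙ b i)ᗮ x‖ = ‖orthogonalProjectionOnto (ℝ ∙ b i)ᗮ y‖) →
      ‖x‖ = ‖y‖) {i j : ι} (hij : i ≠ j) : ⟪b i, b j⟫ = 0 := by
  classical
  have : CompleteSpace E := FiniteDimensional.complete ℝ E
  set ψ : ι → E := fun k =>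
    (InnerProductSpace.toDual ℝ E).symm (LinearMap.toContinuousLinearMap (b.coord k)) with hψdef
  have hψ (k : ι) (x : E) : ⟪ψ k, x⟫ = b.repr x k := by
    simp [hψdef, InnerProductSpace.toDual_symm_apply]
  have hbi (k l : ι) : ⟪b k, ψ l⟫ = if k = l then 1 else 0 := by
    rw [real_inner_comm, hψ, b.repr_self, Finsupp.single_apply]
  have hψj : ψ j = ⟪ψ j, ψ j⟫ • b j := by
    conv_lhs => rw [← b.sum_repr (ψ j)]
    rw [Finset.sum_eq_single j, hψ]
    · intro k _ hk
      rw [← hψ, inner_eq_zero_of_biorthogonal_of_hyperplane_norm_retrieval hunit hNR hbi hk,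
        zero_smul]
    · simp
  have hψ0 : ⟪ψ j, ψ j⟫ ≠ 0 := by
    intro h
    have := hbi j j
    rw [inner_self_eq_zero.mp h] at this
    simp at this
  have h := hbi i j
  rw [hψj, inner_smul_right, if_neg hij] at h
  exact (mul_eq_zero.mp h).resolve_left hψ0

end

/-- If the hyperplanes `(φ i)ᗮ` of a linearly independent family of `N` unit vectors in `ℝ^N`
do norm retrieval, then `{φ i}` is an orthonormal basis, i.e. pairwise orthogonal. -/
theorem stmt_2 (N : ℕ) (φ : Fin N → EuclideanSpace ℝ (Fin N))
    (hind : LinearIndependent ℝ φ) (hunit : ∀ i, ‖φ i‖ = 1)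
    (hNR : ∀ x y : EuclideanSpace ℝ (Fin N),
      (∀ i, ‖orthogonalProjection (ℝ ∙ φ i)ᗮ x‖ = ‖orthogonalProjection (ℝ ∙ φ i)ᗮ y‖) →
      ‖x‖ = ‖y‖) :
    ∀ i j, i ≠ j → ⟪φ i, φ j⟫ = 0 := by
  intro i j hij
  have hb := coe_basisOfLinearIndependentOfCardEqFinrank' φ hind (by simp)
  rw [← hb] at hunit hNR ⊢
  exact Module.Basis.inner_eq_zero_of_hyperplane_norm_retrieval _ hunit hNR hij
end

section
/- Let {W_i}_{i=1}^M be subspaces of ℝ^N with corresponding orthogonal projections {P_i}_{i=1}^M, and let N_i = dim W_i. Then the following are equivalent: (1) the family of subspaces {W_i}_{i=1}^M does phase retrieval; (2) for every choice of orthonormal bases {φ_{ij}}_{j=1}^{N_i} of W_i for each i ∈ [M], the combined collection of vectors {φ_{ij} : i ∈ [M], j ∈ [N_i]} does phase retrieval. -/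
open Submodule
open scoped RealInnerProductSpace

/-- Every vector `w` lies on an axis of some orthonormal basis: each basis vector is orthogonal
to `w` or to the whole orthogonal complement of `w`. -/
theorem exists_orthonormalBasis_inner_eq_zero_or {E : Type*} [NormedAddCommGroup E]
    [InnerProductSpace ℝ E] [FiniteDimensional ℝ E] (w : E) :
    ∃ b : OrthonormalBasis (Fin (Module.finrank ℝ E)) ℝ E,
      ∀ j z, ⟪w, z⟫ = 0 → ⟪w, b j⟫ = 0 ∨ ⟪z, b j⟫ = 0 := by
  classical
  rcases eq_or_ne w 0 with rfl | hw
  · exact ⟨stdOrthonormalBasis ℝ E, fun j z _ => Or.inl (inner_zero_left _)⟩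
  have hv : Orthonormal ℝ ((↑) : ({(‖w‖⁻¹ : ℝ) • w} : Set E) → E) := by
    refine ⟨?_, fun i j hij => (hij (Subsingleton.elim i j)).elim⟩
    rintro ⟨_, rfl⟩
    exact norm_smul_inv_norm (𝕜 := ℝ) hw
  obtain ⟨u, b, hu, hb⟩ := hv.exists_orthonormalBasis_extension
  have hcard : Fintype.card u = Fintype.card (Fin (Module.finrank ℝ E)) := by
    rw [Fintype.card_fin, Module.finrank_eq_card_basis b.toBasis]
  refine ⟨b.reindex (Fintype.equivOfCardEq hcard), fun j z hz => ?_⟩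
  rw [b.reindex_apply]
  set k := (Fintype.equivOfCardEq hcard).symm j
  let k₀ : u := ⟨(‖w‖⁻¹ : ℝ) • w, hu rfl⟩
  have hk₀ : b k₀ = (‖w‖⁻¹ : ℝ) • w := by rw [hb]
  by_cases h : k = k₀
  · right
    rw [h, hk₀, inner_smul_right, real_inner_comm, hz, mul_zero]
  · left
    have h0 := b.orthonormal.2 (Ne.symm h)
    simpa [hk₀, inner_smul_left, hw] using h0

/-- Two vectors of equal norm have coordinates of equal absolute value in some orthonormal
basis. -/
theorem exists_orthonormalBasis_abs_inner_eq {E : Type*} [NormedAddCommGroup E]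
    [InnerProductSpace ℝ E] [FiniteDimensional ℝ E] {u v : E} (h : ‖u‖ = ‖v‖) :
    ∃ b : OrthonormalBasis (Fin (Module.finrank ℝ E)) ℝ E, ∀ j, |⟪u, b j⟫| = |⟪v, b j⟫| := by
  obtain ⟨b, hb⟩ := exists_orthonormalBasis_inner_eq_zero_or (u + v)
  refine ⟨b, fun j => ?_⟩
  rw [abs_eq_abs]
  rcases hb j (u - v) ((real_inner_add_sub_eq_zero_iff u v).2 h) with h | h
  · rw [inner_add_left] at h
    exact Or.inr (by linarith)
  · rw [inner_sub_left] at h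
    exact Or.inl (by linarith)

/-- The norm of an orthogonal projection is determined by the coordinates in any orthonormal
spanning family of the subspace. -/
theorem norm_orthogonalProjectionOnto_sq_eq_sum {E ι : Type*} [NormedAddCommGroup E]
    [InnerProductSpace ℝ E] [Fintype ι] (K : Submodule ℝ E) [K.HasOrthogonalProjection]
    {φ : ι → E} (ho : Orthonormal ℝ φ) (hm : ∀ j, φ j ∈ K)
    (hs : Submodule.span ℝ (Set.range φ) = K) (x : E) :
    ‖K.orthogonalProjectionOnto x‖ ^ 2 = ∑ j, |⟪x, φ j⟫| ^ 2 := by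
  have ho' : Orthonormal ℝ (fun j => (⟨φ j, hm j⟩ : K)) :=
    ho.codRestrict K hm
  have hs' : ⊤ ≤ Submodule.span ℝ (Set.range (fun j => (⟨φ j, hm j⟩ : K))) := by
    rw [← Submodule.map_le_map_iff_of_injective K.injective_subtype, Submodule.map_span,
      ← Set.range_comp, Submodule.map_top, Submodule.range_subtype]
    exact hs.ge
  let b := OrthonormalBasis.mk ho' hs'
  rw [← b.sum_sq_norm_inner_left]
  refine Finset.sum_congr rfl fun j _ => ?_
  rw [Real.norm_eq_abs, inner_orthogonalProjectionOnto_eq_of_mem_right]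
  simp [b]

/-- A family of subspaces of `ℝ^N` does phase retrieval if and only if, for every choice
of orthonormal bases of the subspaces, the combined family of basis vectors does phase
retrieval. -/
theorem stmt_6 (N M : ℕ) (W : Fin M → Submodule ℝ (EuclideanSpace ℝ (Fin N))) :
    (∀ x y : EuclideanSpace ℝ (Fin N),
      (∀ i, ‖orthogonalProjection (W i) x‖ = ‖orthogonalProjection (W i) y‖) →
      x = y ∨ x = -y)
    ↔ (∀ φ : (i : Fin M) → Fin (Module.finrank ℝ (W i)) → EuclideanSpace ℝ (Fin N),
      (∀ i, Orthonormal ℝ (φ i) ∧ (∀ j, φ i j ∈ W i) ∧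
        Submodule.span ℝ (Set.range (φ i)) = W i) →
      ∀ x y : EuclideanSpace ℝ (Fin N),
        (∀ p : (i : Fin M) × Fin (Module.finrank ℝ (W i)),
          |⟪x, φ p.1 p.2⟫| = |⟪y, φ p.1 p.2⟫|) →
        x = y ∨ x = -y) := by
  constructor
  · intro h φ hφ x y hxy
    refine h x y fun i => ?_
    obtain ⟨ho, hm, hs⟩ := hφ i
    rw [← sq_eq_sq₀ (norm_nonneg _) (norm_nonneg _),
      norm_orthogonalProjectionOnto_sq_eq_sum (W i) ho hm hs,
      norm_orthogonalProjectionOnto_sq_eq_sum (W i) ho hm hs]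
    exact Finset.sum_congr rfl fun j _ => by rw [hxy ⟨i, j⟩]
  · intro h x y hxy
    choose b hb using fun i => exists_orthonormalBasis_abs_inner_eq (hxy i)
    refine h (fun i j => b i j) (fun i => ⟨?_, fun j => (b i j).2, ?_⟩) x y fun p => ?_
    · exact (b i).orthonormal.comp_linearIsometry (W i).subtypeₗᵢ
    · have hspan := congrArg (Submodule.map (W i).subtype) (b i).toBasis.span_eq
      rwa [Submodule.map_span, ← Set.range_comp, Submodule.map_top, Submodule.range_subtype,
        (b i).coe_toBasis] at hspan
    · simpa only [inner_orthogonalProjectionOnto_eq_of_mem_right] using hb p.1 p.2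
end

section
/- Let {P_i}_{i=1}^M be orthogonal projections on ℝ^N. Then the following are equivalent: (1) {P_i}_{i=1}^M does norm retrieval; (2) for every x ∈ ℝ^N, the orthogonal complement of span{P_i x : i ∈ [M]} is contained in x^⊥; (3) for every x ∈ ℝ^N, x ∈ span{P_i x : i ∈ [M]}. -/
open Submodule
open scoped RealInnerProductSpace

/-- The inner product with a projected vector may be computed inside the subspace. -/
theorem inner_coe_orthogonalProjectionOnto_left {E : Type*} [NormedAddCommGroup E]
    [InnerProductSpace ℝ E] (K : Submodule ℝ E) [K.HasOrthogonalProjection] (x y : E) :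
    ⟪(orthogonalProjectionOnto K x : E), y⟫ =
      ⟪orthogonalProjectionOnto K x, orthogonalProjectionOnto K y⟫ := by
  simp

/-- `y` is orthogonal to the span of a range iff it is orthogonal to each member. -/
theorem mem_orthogonal_span_range_iff {E ι : Type*} [NormedAddCommGroup E]
    [InnerProductSpace ℝ E] (f : ι → E) (y : E) :
    y ∈ (span ℝ (Set.range f))ᗮ ↔ ∀ i, ⟪f i, y⟫ = 0 := by
  rw [← SetLike.mem_coe, ← Set.singleton_subset_iff, ← span_le,
    ← isOrtho_iff_le, isOrtho_span]
  simp [real_inner_comm y]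

/-- For orthogonal projections `P i` onto subspaces `W i` of `ℝ^N`, the following are
equivalent: (1) they do norm retrieval; (2) for every `x`,
`(span {P i x})ᗮ ⊆ xᗮ`; (3) for every `x`, `x ∈ span {P i x}`. -/
theorem stmt_7 (N M : ℕ) (W : Fin M → Submodule ℝ (EuclideanSpace ℝ (Fin N))) :
    List.TFAE [
      ∀ x y : EuclideanSpace ℝ (Fin N),
        (∀ i, ‖orthogonalProjection (W i) x‖ = ‖orthogonalProjection (W i) y‖) →
        ‖x‖ = ‖y‖,
      ∀ x : EuclideanSpace ℝ (Fin N),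
        (Submodule.span ℝ (Set.range fun i =>
          (orthogonalProjection (W i) x : EuclideanSpace ℝ (Fin N))))ᗮ ≤ (ℝ ∙ x)ᗮ,
      ∀ x : EuclideanSpace ℝ (Fin N),
        x ∈ Submodule.span ℝ (Set.range fun i =>
          (orthogonalProjection (W i) x : EuclideanSpace ℝ (Fin N)))] := by
  tfae_have 1 → 2 := by
    intro h x y hy
    rw [mem_orthogonal_span_range_iff] at hy
    rw [mem_orthogonal_singleton_iff_inner_right]
    have hxy : ‖x + y‖ = ‖x - y‖ := h _ _ fun i => by
      have hi := hy i
      rw [inner_coe_orthogonalProjectionOnto_left] at hi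
      rw [map_add, map_sub, ← sq_eq_sq₀ (norm_nonneg _) (norm_nonneg _), norm_add_sq_real,
        norm_sub_sq_real, hi]
      ring
    have hsq := congrArg (· ^ 2) hxy
    simp only [norm_add_sq_real, norm_sub_sq_real] at hsq
    linarith
  tfae_have 2 → 1 := by
    intro h x y hxy
    have hmem := h (x + y) ((mem_orthogonal_span_range_iff _ (x - y)).2 fun i => by
      rw [inner_coe_orthogonalProjectionOnto_left, map_add, map_sub,
        real_inner_add_sub_eq_zero_iff]
      exact hxy i)
    rwa [mem_orthogonal_singleton_iff_inner_right, real_inner_add_sub_eq_zero_iff] at hmem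
  tfae_have 2 ↔ 3 := by
    refine forall_congr' fun x => ?_
    rw [orthogonal_le_orthogonal_iff, span_singleton_le_iff_mem]
  tfae_finish
end

section
/- A frame {φ_i}_{i=1}^M for ℝ^N does norm retrieval if and only if for every partition {I_1, I_2} of [M], the subspaces (span{φ_i : i ∈ I_1})^⊥ and (span{φ_i : i ∈ I_2})^⊥ are orthogonal to each other. -/
open Submodule
open scoped RealInnerProductSpace

theorem mem_orthogonal_span_iff_forall_inner_eq_zero {E : Type*} [NormedAddCommGroup E]
    [InnerProductSpace ℝ E] (s : Set E) (u : E) :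
    u ∈ (Submodule.span ℝ s)ᗮ ↔ ∀ w ∈ s, ⟪u, w⟫ = 0 := by
  rw [Submodule.mem_orthogonal']
  refine ⟨fun h w hw => h w (Submodule.subset_span hw), fun h w hw => ?_⟩
  induction hw using Submodule.span_induction with
  | mem w hw => exact h w hw
  | zero => exact inner_zero_right u
  | add a b _ _ ha hb => rw [inner_add_right, ha, hb, add_zero]
  | smul c a _ ha => rw [inner_smul_right, ha, mul_zero]

/-- A frame `{φ i}` for `ℝ^N` does norm retrieval if and only if for every partition
`{I, Iᶜ}` of the index set, `(span {φ i : i ∈ I})ᗮ` is orthogonal to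
`(span {φ i : i ∈ Iᶜ})ᗮ`. -/
theorem stmt_8 (N M : ℕ) (φ : Fin M → EuclideanSpace ℝ (Fin N))
    (hframe : Submodule.span ℝ (Set.range φ) = ⊤) :
    (∀ x y : EuclideanSpace ℝ (Fin N),
      (∀ i, |⟪x, φ i⟫| = |⟪y, φ i⟫|) → ‖x‖ = ‖y‖)
    ↔ ∀ I : Finset (Fin M),
      ∀ u ∈ (Submodule.span ℝ (φ '' (I : Set (Fin M))))ᗮ,
      ∀ v ∈ (Submodule.span ℝ (φ '' ((I : Set (Fin M)))ᶜ))ᗮ,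
      ⟪u, v⟫ = 0 := by
  simp only [mem_orthogonal_span_iff_forall_inner_eq_zero, Set.forall_mem_image]
  constructor
  · intro h I u hu v hv
    have huv : ‖u + v‖ = ‖u - v‖ := by
      refine h _ _ fun i => ?_
      by_cases hi : i ∈ (I : Set (Fin M))
      · simp [inner_add_left, inner_sub_left, hu hi]
      · simp [inner_add_left, inner_sub_left, hv hi]
    have hsq := congrArg (· ^ 2) huv
    simp only [norm_add_sq_real, norm_sub_sq_real] at hsq
    linarith
  · intro h x y hxy
    rw [← real_inner_add_sub_eq_zero_iff, real_inner_comm]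
    refine h (Finset.univ.filter fun i => ⟪x, φ i⟫ = ⟪y, φ i⟫) _ ?_ _ ?_
    · intro i hi
      have hi' : ⟪x, φ i⟫ = ⟪y, φ i⟫ := by simpa using hi
      rw [inner_sub_left, hi', sub_self]
    · intro i hi
      have hi' : ¬ ⟪x, φ i⟫ = ⟪y, φ i⟫ := by simpa using hi
      rw [inner_add_left, (abs_eq_abs.mp (hxy i)).resolve_left hi', neg_add_cancel]
end

section
/- Suppose the family of vectors {φ_i}_{i=1}^M does norm retrieval in ℝ^N. Then for every j ∈ [M], if φ_j ∉ span{φ_i : i ∈ [M], i ≠ j}, then ⟨φ_j, φ_i⟩ = 0 for all i ≠ j. -/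
open Submodule
open scoped RealInnerProductSpace

/-- If `{φ i}` does norm retrieval in `ℝ^N` and `φ j` is not in the span of the other
vectors, then `φ j` is orthogonal to all the other vectors. -/
theorem stmt_9 (N M : ℕ) (φ : Fin M → EuclideanSpace ℝ (Fin N))
    (hNR : ∀ x y : EuclideanSpace ℝ (Fin N),
      (∀ i, |⟪x, φ i⟫| = |⟪y, φ i⟫|) → ‖x‖ = ‖y‖)
    (j : Fin M)
    (hj : φ j ∉ Submodule.span ℝ (φ '' {i | i ≠ j})) :
    ∀ i, i ≠ j → ⟪φ j, φ i⟫ = 0 := by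
  set K := Submodule.span ℝ (φ '' {i | i ≠ j})
  have mem_K : ∀ i, i ≠ j → φ i ∈ K := fun i hi => subset_span ⟨i, hi, rfl⟩
  obtain ⟨p, hp, q, hq, hpq⟩ := K.exists_add_mem_mem_orthogonal (φ j)
  have hq_ne : q ≠ 0 := by
    rintro rfl
    exact hj (by simpa [hpq] using hp)
  have hq_sq : ‖q‖ ^ 2 ≠ 0 := by simpa using hq_ne
  have h_inner_pq : ⟪p, q⟫ = 0 := hq p hp
  have h_inner_qp : ⟪q, p⟫ = 0 := by rw [real_inner_comm, h_inner_pq]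
  set b : ℝ := -2 * (‖p‖ ^ 2 / ‖q‖ ^ 2) with hb
  have h_norm : ‖p‖ = ‖p + b • q‖ := by
    refine hNR _ _ fun i => ?_
    by_cases hi : i = j
    · rw [hi, hpq, ← abs_neg]
      congr 1
      simp only [inner_add_left, inner_add_right, real_inner_smul_left, h_inner_pq, h_inner_qp,
        real_inner_self_eq_norm_sq, hb]
      field_simp
      ring
    · have hqi : ⟪q, φ i⟫ = 0 := by
        rw [real_inner_comm]
        exact hq _ (mem_K i hi)
      simp [inner_add_left, real_inner_smul_left, hqi]
  have h_b_sq : b ^ 2 * ‖q‖ ^ 2 = 0 := by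
    have h := norm_add_sq_real p (b • q)
    rw [← h_norm, real_inner_smul_right, h_inner_pq, norm_smul, mul_pow, Real.norm_eq_abs,
      sq_abs] at h
    linarith
  have hp_zero : p = 0 := by
    simpa [hb, hq_ne] using h_b_sq
  intro i hi
  rw [hpq, hp_zero, zero_add, real_inner_comm]
  exact hq _ (mem_K i hi)
end

section
/- A basis {φ_i}_{i=1}^N of ℝ^N does norm retrieval if and only if it is an orthogonal basis, i.e., ⟨φ_i, φ_j⟩ = 0 for all i ≠ j. -/
open Submodule
open scoped RealInnerProductSpace

section NormRetrieval

variable {ι E : Type*} [NormedAddCommGroup E] [InnerProductSpace ℝ E]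

/-- The Riesz representatives of the coordinate functionals of a basis. -/
theorem Module.Basis.exists_inner_eq_repr [FiniteDimensional ℝ E] (b : Module.Basis ι ℝ E) :
    ∃ d : ι → E, ∀ i x, ⟪d i, x⟫ = b.repr x i := by
  have := FiniteDimensional.complete ℝ E
  exact ⟨fun i => (InnerProductSpace.toDual ℝ E).symm (b.coord i).toContinuousLinearMap,
    fun i x => by simp⟩

variable [Fintype ι]

/-- Parseval's identity for an orthogonal, not necessarily normalized, basis. -/
theorem Module.Basis.norm_sq_eq_sum_of_orthogonal (b : Module.Basis ι ℝ E)
    (hb : ∀ i j, i ≠ j → ⟪b i, b j⟫ = 0) (x : E) :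
    ‖x‖ ^ 2 = ∑ i, ⟪x, b i⟫ ^ 2 / ‖b i‖ ^ 2 := by
  classical
  have hcoord (i : ι) : ⟪x, b i⟫ = b.repr x i * ‖b i‖ ^ 2 := by
    conv_lhs => rw [← b.sum_repr x]
    rw [sum_inner, Finset.sum_eq_single i]
    · rw [real_inner_smul_left, real_inner_self_eq_norm_sq]
    · intro j _ hj
      rw [real_inner_smul_left, hb j i hj, mul_zero]
    · simp
  have hexpand : ‖x‖ ^ 2 = ∑ i, b.repr x i * ⟪x, b i⟫ := by
    rw [← real_inner_self_eq_norm_sq]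
    nth_rw 2 [← b.sum_repr x]
    simp only [inner_sum, real_inner_smul_right]
  rw [hexpand]
  refine Finset.sum_congr rfl fun i _ => ?_
  have hi : ‖b i‖ ≠ 0 := norm_ne_zero_iff.mpr (b.ne_zero i)
  rw [hcoord]
  field_simp

/-- A basis admitting a biorthogonal family that is itself orthogonal is orthogonal. -/
theorem Module.Basis.orthogonal_of_dual_orthogonal (b : Module.Basis ι ℝ E) (d : ι → E)
    (hd : ∀ i x, ⟪d i, x⟫ = b.repr x i) (hdd : ∀ i j, i ≠ j → ⟪d i, d j⟫ = 0)
    {i j : ι} (hij : i ≠ j) : ⟪b i, b j⟫ = 0 := by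
  classical
  have hdi : d i = ⟪d i, d i⟫ • b i := by
    conv_lhs => rw [← b.sum_repr (d i)]
    rw [Finset.sum_eq_single i]
    · rw [← hd]
    · intro k _ hk
      rw [← hd, hdd k i hk, zero_smul]
    · simp
  have hzero : ⟪d i, d i⟫ * ⟪b i, b j⟫ = 0 := by
    rw [← real_inner_smul_left, ← hdi, hd, b.repr_self, Finsupp.single_eq_of_ne hij]
  refine (mul_eq_zero.mp hzero).resolve_left fun h => ?_
  have hone : ⟪d i, b i⟫ = 1 := by rw [hd, b.repr_self, Finsupp.single_eq_same]
  rw [inner_self_eq_zero.mp h, inner_zero_left] at hone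
  exact zero_ne_one hone

theorem Module.Basis.normRetrieval_iff_orthogonal [FiniteDimensional ℝ E]
    (b : Module.Basis ι ℝ E) :
    (∀ x y : E, (∀ i, |⟪x, b i⟫| = |⟪y, b i⟫|) → ‖x‖ = ‖y‖) ↔
      ∀ i j, i ≠ j → ⟪b i, b j⟫ = 0 := by
  classical
  constructor
  · intro h i j hij
    obtain ⟨d, hd⟩ := b.exists_inner_eq_repr
    refine b.orthogonal_of_dual_orthogonal d hd (fun k l hkl => ?_) hij
    have hnorm : ‖d k + d l‖ = ‖d k - d l‖ := by
      refine h _ _ fun m => ?_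
      simp only [inner_add_left, inner_sub_left, hd, b.repr_self]
      rcases eq_or_ne k m with rfl | hkm
      · simp [Finsupp.single_eq_of_ne hkl.symm]
      · simp [Finsupp.single_eq_of_ne hkm]
    have hadd := norm_add_sq_real (d k) (d l)
    have hsub := norm_sub_sq_real (d k) (d l)
    rw [hnorm] at hadd
    linarith
  · intro h x y hxy
    rw [← sq_eq_sq₀ (norm_nonneg x) (norm_nonneg y), b.norm_sq_eq_sum_of_orthogonal h,
      b.norm_sq_eq_sum_of_orthogonal h]
    refine Finset.sum_congr rfl fun i _ => ?_
    rw [(sq_eq_sq_iff_abs_eq_abs _ _).mpr (hxy i)]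

end NormRetrieval

/-- A basis `{φ i}` of `ℝ^N` does norm retrieval if and only if it is an orthogonal
basis. -/
theorem stmt_10 (N : ℕ) (φ : Fin N → EuclideanSpace ℝ (Fin N))
    (hind : LinearIndependent ℝ φ)
    (hspan : Submodule.span ℝ (Set.range φ) = ⊤) :
    (∀ x y : EuclideanSpace ℝ (Fin N),
      (∀ i, |⟪x, φ i⟫| = |⟪y, φ i⟫|) → ‖x‖ = ‖y‖)
    ↔ ∀ i j, i ≠ j → ⟪φ i, φ j⟫ = 0 := by
  simpa using (Module.Basis.mk hind hspan.ge).normRetrieval_iff_orthogonal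
end

section
/- Let {W_i}_{i=1}^M be subspaces of ℝ^N such that the sum of their dimensions equals N. Then the family {W_i}_{i=1}^M does norm retrieval if and only if the subspaces are pairwise orthogonal, i.e., ⟨u, v⟩ = 0 whenever u ∈ W_i, v ∈ W_j and i ≠ j. -/
open Submodule
open scoped RealInnerProductSpace

/-- If the orthogonal projections onto subspaces with total dimension `dim E` have no common
nonzero kernel vector, then they can be prescribed arbitrarily. -/
lemma exists_forall_orthogonalProjection_eq {ι E : Type*} [Fintype ι] [NormedAddCommGroup E]
    [InnerProductSpace ℝ E] [FiniteDimensional ℝ E] (W : ι → Submodule ℝ E)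
    (hdim : ∑ i, Module.finrank ℝ (W i) = Module.finrank ℝ E)
    (hker : ∀ x : E, (∀ i, orthogonalProjectionOnto (W i) x = 0) → x = 0) (w : ∀ i, W i) :
    ∃ x : E, ∀ i, orthogonalProjectionOnto (W i) x = w i := by
  let T : E →ₗ[ℝ] (∀ i, W i) :=
    LinearMap.pi fun i => (orthogonalProjectionOnto (W i)).toLinearMap
  have hinj : Function.Injective T := by
    rw [injective_iff_map_eq_zero]
    exact fun x hx => hker x fun i => congrFun hx i
  have hsurj : Function.Surjective T :=
    (LinearMap.injective_iff_surjective_of_finrank_eq_finrank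
      (by rw [Module.finrank_pi_fintype, hdim])).1 hinj
  obtain ⟨x, hx⟩ := hsurj w
  exact ⟨x, fun i => congrFun hx i⟩

/-- Norm retrieval forces subspaces with total dimension `dim E` to be pairwise orthogonal. -/
lemma inner_eq_zero_of_norm_retrieval {ι E : Type*} [Fintype ι] [NormedAddCommGroup E]
    [InnerProductSpace ℝ E] [FiniteDimensional ℝ E] (W : ι → Submodule ℝ E)
    (hdim : ∑ i, Module.finrank ℝ (W i) = Module.finrank ℝ E)
    (h : ∀ x y : E, (∀ i, ‖orthogonalProjectionOnto (W i) x‖ = ‖orthogonalProjectionOnto (W i) y‖) →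
      ‖x‖ = ‖y‖) {i j : ι} (hij : i ≠ j) {u v : E} (hu : u ∈ W i) (hv : v ∈ W j) :
    ⟪u, v⟫ = 0 := by
  classical
  have hker (x : E) (hx : ∀ i, orthogonalProjectionOnto (W i) x = 0) : x = 0 := by
    simpa using h x 0 fun i => by simp [hx i]
  obtain ⟨q, hq⟩ := exists_forall_orthogonalProjection_eq W hdim hker
    (Pi.single j (orthogonalProjectionOnto (W j) u))
  have hqj : orthogonalProjectionOnto (W j) q = orthogonalProjectionOnto (W j) u := by simp [hq]
  have hqk (k : ι) (hk : k ≠ j) : orthogonalProjectionOnto (W k) q = 0 := by simp [hq, hk]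
  have hnorm : ‖(u - q) + q‖ = ‖(u - q) - q‖ := by
    refine h _ _ fun k => ?_
    by_cases hk : k = j
    · subst hk
      simp [hqj]
    · simp [hqk k hk]
  have huq : ⟪u, q⟫ = 0 := by
    have := orthogonalProjectionOnto_eq_zero_iff.1 (hqk i hij)
    exact this u hu
  have hrq : ⟪u - q, q⟫ = 0 := by
    have h1 := norm_add_sq_real (u - q) q
    have h2 := norm_sub_sq_real (u - q) q
    rw [hnorm] at h1
    linarith
  have hq0 : q = 0 := by
    rw [inner_sub_left, huq, zero_sub, neg_eq_zero] at hrq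
    exact inner_self_eq_zero.1 hrq
  have huj : orthogonalProjectionOnto (W j) u = 0 := by rw [← hqj, hq0, map_zero]
  rw [real_inner_comm]
  exact orthogonalProjectionOnto_eq_zero_iff.1 huj v hv

/-- Pairwise orthogonal subspaces with total dimension `dim E` do norm retrieval. -/
lemma norm_eq_of_orthogonalFamily {ι E : Type*} [Fintype ι] [NormedAddCommGroup E]
    [InnerProductSpace ℝ E] [FiniteDimensional ℝ E] (W : ι → Submodule ℝ E)
    (hdim : ∑ i, Module.finrank ℝ (W i) = Module.finrank ℝ E)
    (hW : OrthogonalFamily ℝ (fun i => W i) fun i => (W i).subtypeₗᵢ) {x y : E}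
    (hxy : ∀ i, ‖orthogonalProjectionOnto (W i) x‖ = ‖orthogonalProjectionOnto (W i) y‖) :
    ‖x‖ = ‖y‖ := by
  classical
  have htop : iSup W = ⊤ := by
    have hsurj : Function.Surjective (DirectSum.coeLinearMap W) :=
      (LinearMap.injective_iff_surjective_of_finrank_eq_finrank
        (by rw [Module.finrank_directSum, hdim])).1 hW.independent.dfinsupp_lsum_injective
    rw [← DirectSum.range_coeLinearMap, LinearMap.range_eq_top.2 hsurj]
  have hsq (z : E) : ‖z‖ ^ 2 = ∑ i, ‖orthogonalProjectionOnto (W i) z‖ ^ 2 := by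
    have hz := hW.sum_projection_of_mem_iSup z (htop ▸ mem_top)
    conv_lhs => rw [← hz]
    exact hW.norm_sum (fun i => orthogonalProjectionOnto (W i) z) Finset.univ
  have : ‖x‖ ^ 2 = ‖y‖ ^ 2 := by simp only [hsq, hxy]
  exact (sq_eq_sq₀ (norm_nonneg x) (norm_nonneg y)).1 this

/-- If subspaces `{W i}` of `ℝ^N` have dimensions summing to `N`, then they do norm
retrieval if and only if they are pairwise orthogonal. -/
theorem stmt_11 (N M : ℕ) (W : Fin M → Submodule ℝ (EuclideanSpace ℝ (Fin N)))
    (hdim : ∑ i, Module.finrank ℝ (W i) = N) :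
    (∀ x y : EuclideanSpace ℝ (Fin N),
      (∀ i, ‖orthogonalProjection (W i) x‖ = ‖orthogonalProjection (W i) y‖) →
      ‖x‖ = ‖y‖)
    ↔ ∀ i j, i ≠ j → ∀ u ∈ W i, ∀ v ∈ W j, ⟪u, v⟫ = 0 := by
  have hdim' : ∑ i, Module.finrank ℝ (W i) = Module.finrank ℝ (EuclideanSpace ℝ (Fin N)) := by
    rw [hdim, finrank_euclideanSpace_fin]
  constructor
  · intro h i j hij u hu v hv
    exact inner_eq_zero_of_norm_retrieval W hdim' h hij hu hv
  · intro h x y hxy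
    exact norm_eq_of_orthogonalFamily W hdim'
      (fun i j hij u v => h i j hij u u.2 v v.2) hxy
end

section
/- Let {W_i}_{i=1}^M be subspaces of ℝ^N which do phase retrieval and assume that the sum of their dimensions equals 2N − 1. Then W_i ∩ W_j = {0} for all i ≠ j. -/
open Submodule
open scoped RealInnerProductSpace

section Dimension

variable {K V ι : Type*} [DivisionRing K] [AddCommGroup V] [Module K V] [FiniteDimensional K V]
  [Fintype ι]

theorem finrank_iSup_le_sum_finrank (A : ι → Submodule K V) :
    Module.finrank K (⨆ i, A i : Submodule K V) ≤ ∑ i, Module.finrank K (A i) := by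
  classical
  rw [← Finset.sup_univ_eq_iSup]
  induction (Finset.univ : Finset ι) using Finset.induction_on with
  | empty => simp
  | insert a s ha ih =>
    rw [Finset.sup_insert, Finset.sum_insert ha]
    exact (Submodule.finrank_add_le_finrank_add_finrank _ _).trans (by gcongr)

/-- A family of subspaces of the `W i` can be enlarged inside the `W i` to any admissible total
dimension, without decreasing the gap between the total dimension and the dimension of the sum. -/
theorem exists_le_family_sum_finrank_eq {A W : ι → Submodule K V} (hAW : A ≤ W) {n : ℕ}
    (hAn : ∑ i, Module.finrank K (A i) ≤ n) (hnW : n ≤ ∑ i, Module.finrank K (W i)) :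
    ∃ B ≤ W, ∑ i, Module.finrank K (B i) = n ∧
      Module.finrank K (⨆ i, B i : Submodule K V) + ∑ i, Module.finrank K (A i) ≤
        Module.finrank K (⨆ i, A i : Submodule K V) + n := by
  classical
  induction n, hAn using Nat.le_induction with
  | base => exact ⟨A, hAW, rfl, le_rfl⟩
  | succ n _ ih =>
    obtain ⟨B, hBW, hBn, hB⟩ := ih (by omega)
    obtain ⟨k, -, hk⟩ := Finset.exists_lt_of_sum_lt (show
      ∑ i, Module.finrank K (B i) < ∑ i, Module.finrank K (W i) by omega)
    obtain ⟨w, hwW, hwB⟩ : ∃ w ∈ W k, w ∉ B k := by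
      by_contra! h
      exact absurd (Submodule.finrank_mono h) (by omega)
    refine ⟨Function.update B k (B k ⊔ span K {w}), ?_, ?_, ?_⟩
    · rw [update_le_iff]
      exact ⟨sup_le (hBW k) (by simpa using hwW), fun j _ => hBW j⟩
    · rw [← hBn, ← Finset.add_sum_erase _ _ (Finset.mem_univ k),
        ← Finset.add_sum_erase Finset.univ (fun i => Module.finrank K (B i)) (Finset.mem_univ k),
        Finset.sum_congr rfl fun i hi => by
          rw [Function.update_of_ne (Finset.ne_of_mem_erase hi)],
        Function.update_self, finrank_sup_span_singleton hwB]
      ring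
    · have hle : (⨆ i, Function.update B k (B k ⊔ span K {w}) i) ≤ (⨆ i, B i) ⊔ span K {w} := by
        refine iSup_le fun i => ?_
        rcases eq_or_ne i k with rfl | hik
        · rw [Function.update_self]
          exact sup_le_sup_right (le_iSup B i) _
        · rw [Function.update_of_ne hik]
          exact (le_iSup B i).trans le_sup_left
      have h₁ := Submodule.finrank_mono hle
      have h₂ := Submodule.finrank_add_le_finrank_add_finrank (⨆ i, B i) (span K {w})
      have h₃ : Module.finrank K (span K {w}) ≤ 1 := by
        simpa using finrank_span_le_card (R := K) ({w} : Set V)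
      omega

end Dimension

/-- The complement property for subspaces doing phase retrieval. -/
theorem iSup_eq_top_or_of_phaseRetrieval {E ι : Type*} [NormedAddCommGroup E]
    [InnerProductSpace ℝ E] [FiniteDimensional ℝ E] {W : ι → Submodule ℝ E}
    (hPR : ∀ x y : E,
      (∀ i, ‖(W i).orthogonalProjectionOnto x‖ = ‖(W i).orthogonalProjectionOnto y‖) →
      x = y ∨ x = -y)
    {A : ι → Submodule ℝ E} (hAW : A ≤ W) :
    ⨆ i, A i = ⊤ ∨ ⨆ i, (A i)ᗮ ⊓ W i = ⊤ := by
  have : IsAddTorsionFree E := .of_isTorsionFree ℝ E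
  by_contra! h
  obtain ⟨u, hu, hu0⟩ := Submodule.exists_mem_ne_zero_of_ne_bot
    (mt Submodule.orthogonal_eq_bot_iff.1 h.1)
  obtain ⟨v, hv, hv0⟩ := Submodule.exists_mem_ne_zero_of_ne_bot
    (mt Submodule.orthogonal_eq_bot_iff.1 h.2)
  have key : ∀ i, ⟪(W i).orthogonalProjectionOnto u, (W i).orthogonalProjectionOnto v⟫ = 0 := by
    intro i
    rw [Submodule.inner_orthogonalProjectionOnto_eq_of_mem_left]
    refine hv _ (le_iSup (fun i => (A i)ᗮ ⊓ W i) i ⟨fun a ha => ?_, Subtype.coe_prop _⟩)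
    exact (Submodule.inner_orthogonalProjectionOnto_eq_of_mem_left ⟨a, hAW i ha⟩ u).trans
      (hu a (le_iSup A i ha))
  rcases hPR (u + v) (u - v) fun i => by
    rw [map_add, map_sub, ← sq_eq_sq₀ (norm_nonneg _) (norm_nonneg _), norm_add_sq_real,
      norm_sub_sq_real, key i]
    ring with h | h
  · exact hv0 (self_eq_neg.1 (by simpa [sub_eq_add_neg] using h))
  · exact hu0 (self_eq_neg.1 (by simpa [sub_eq_add_neg, add_comm v] using h))

/-- If subspaces `{W i}` of `ℝ^N` do phase retrieval and their dimensions sum to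
`2N - 1`, then `W i ∩ W j = {0}` for all `i ≠ j`. -/
theorem stmt_12 (N M : ℕ) (W : Fin M → Submodule ℝ (EuclideanSpace ℝ (Fin N)))
    (hPR : ∀ x y : EuclideanSpace ℝ (Fin N),
      (∀ i, ‖orthogonalProjection (W i) x‖ = ‖orthogonalProjection (W i) y‖) →
      x = y ∨ x = -y)
    (hdim : ∑ i, Module.finrank ℝ (W i) = 2 * N - 1) :
    ∀ i j, i ≠ j → W i ⊓ W j = ⊥ := by
  intro i j hij
  by_contra hne
  obtain ⟨z, ⟨hzi, hzj⟩, hz⟩ := Submodule.exists_mem_ne_zero_of_ne_bot hne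
  set A : Fin M → Submodule ℝ (EuclideanSpace ℝ (Fin N)) :=
    fun k => if k ∈ ({i, j} : Finset (Fin M)) then span ℝ {z} else ⊥ with hA
  have hAW : A ≤ W := by
    intro k
    simp only [hA, Finset.mem_insert, Finset.mem_singleton]
    split_ifs with hk
    · rcases hk with rfl | rfl <;> simpa
    · exact bot_le
  have hAdim : ∑ k, Module.finrank ℝ (A k) = 2 := by
    have (k : Fin M) : Module.finrank ℝ (A k) = if k ∈ ({i, j} : Finset (Fin M)) then 1 else 0 := by
      split_ifs with hk
      · rw [show A k = span ℝ {z} from if_pos hk, finrank_span_singleton hz]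
      · rw [show A k = ⊥ from if_neg hk, finrank_bot]
    simp_rw [this]
    rw [Finset.sum_ite_mem, Finset.univ_inter, Finset.sum_const, Finset.card_pair hij]
    rfl
  have hAsup : Module.finrank ℝ (⨆ k, A k : Submodule ℝ (EuclideanSpace ℝ (Fin N))) ≤ 1 := by
    rw [← finrank_span_singleton (K := ℝ) hz]
    refine Submodule.finrank_mono (iSup_le fun k => ?_)
    simp only [hA]
    split_ifs <;> simp
  have hAWdim : ∑ k, Module.finrank ℝ (A k) ≤ ∑ k, Module.finrank ℝ (W k) :=
    Finset.sum_le_sum fun k _ => Submodule.finrank_mono (hAW k)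
  obtain ⟨B, hBW, hBdim, hB⟩ := exists_le_family_sum_finrank_eq hAW (n := N) (by omega) (by omega)
  have hN : Module.finrank ℝ (⊤ : Submodule ℝ (EuclideanSpace ℝ (Fin N))) = N := by simp
  rcases iSup_eq_top_or_of_phaseRetrieval hPR hBW with h | h
  · rw [h, hN] at hB
    omega
  · have hle := finrank_iSup_le_sum_finrank fun k => (B k)ᗮ ⊓ W k
    rw [h, hN] at hle
    have hsum : ∑ k, Module.finrank ℝ (B k) + ∑ k, Module.finrank ℝ ↥((B k)ᗮ ⊓ W k) =
        ∑ k, Module.finrank ℝ (W k) := by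
      rw [← Finset.sum_add_distrib]
      exact Finset.sum_congr rfl fun k _ => Submodule.finrank_add_inf_finrank_orthogonal (hBW k)
    omega
end

section
/- Let {W_i}_{i=1}^M be subspaces of ℝ^N which do phase retrieval, and suppose that for each i ∈ [M], W_i = U_i ⊕ V_i is an orthogonal direct sum of subspaces U_i and V_i (so U_i ⊥ V_i and W_i = U_i + V_i). Then the family of 2M subspaces {U_1, …, U_M, V_1, …, V_M} does phase retrieval in ℝ^N. -/
open Submodule
open scoped RealInnerProductSpace

theorem norm_sq_orthogonalProjectionOnto_of_eq_sup {E : Type*} [NormedAddCommGroup E]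
    [InnerProductSpace ℝ E] {U V W : Submodule ℝ E} [U.HasOrthogonalProjection]
    [V.HasOrthogonalProjection] [W.HasOrthogonalProjection] (hUV : U ⟂ V) (hW : W = U ⊔ V)
    (x : E) :
    ‖W.orthogonalProjectionOnto x‖ ^ 2 =
      ‖U.orthogonalProjectionOnto x‖ ^ 2 + ‖V.orthogonalProjectionOnto x‖ ^ 2 := by
  subst hW
  have hin : ∀ u ∈ U, ∀ v ∈ V, ⟪u, v⟫ = 0 := isOrtho_iff_inner_eq.mp hUV
  have hproj : (U ⊔ V).starProjection x = U.starProjection x + V.starProjection x := by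
    refine eq_starProjection_of_mem_of_inner_eq_zero
      (add_mem_sup (U.starProjection_apply_mem x) (V.starProjection_apply_mem x)) fun w hw => ?_
    obtain ⟨u, hu, v, hv, rfl⟩ := mem_sup.mp hw
    have hxu := starProjection_inner_eq_zero x u hu
    have hxv := starProjection_inner_eq_zero x v hv
    have hVu := hin u hu _ (V.starProjection_apply_mem x)
    have hUv := hin _ (U.starProjection_apply_mem x) v hv
    rw [real_inner_comm] at hVu
    rw [inner_sub_left] at hxu hxv
    simp only [inner_sub_left, inner_add_left, inner_add_right]
    linarith
  rw [coe_norm, coe_norm, coe_norm]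
  simp only [coe_orthogonalProjectionOnto_apply, hproj, sq]
  exact norm_add_sq_eq_norm_sq_add_norm_sq_real
    (hin _ (U.starProjection_apply_mem x) _ (V.starProjection_apply_mem x))

/-- If subspaces `{W i}` of `ℝ^N` do phase retrieval and each `W i` is the orthogonal
direct sum of subspaces `U i` and `V i`, then the family `{U i} ∪ {V i}` also does phase
retrieval. -/
theorem stmt_13 (N M : ℕ)
    (W U V : Fin M → Submodule ℝ (EuclideanSpace ℝ (Fin N)))
    (horth : ∀ i, ∀ u ∈ U i, ∀ v ∈ V i, ⟪u, v⟫ = 0)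
    (hsum : ∀ i, W i = U i ⊔ V i)
    (hPR : ∀ x y : EuclideanSpace ℝ (Fin N),
      (∀ i, ‖orthogonalProjection (W i) x‖ = ‖orthogonalProjection (W i) y‖) →
      x = y ∨ x = -y) :
    ∀ x y : EuclideanSpace ℝ (Fin N),
      (∀ k : Fin M ⊕ Fin M,
        ‖orthogonalProjection (Sum.elim U V k) x‖ = ‖orthogonalProjection (Sum.elim U V k) y‖) →
      x = y ∨ x = -y := by
  intro x y h
  refine hPR x y fun i => ?_
  have hUV : U i ⟂ V i := isOrtho_iff_inner_eq.mpr (horth i)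
  have hU : ‖orthogonalProjectionOnto (U i) x‖ = ‖orthogonalProjectionOnto (U i) y‖ := h (Sum.inl i)
  have hV : ‖orthogonalProjectionOnto (V i) x‖ = ‖orthogonalProjectionOnto (V i) y‖ := h (Sum.inr i)
  rw [← sq_eq_sq₀ (norm_nonneg _) (norm_nonneg _),
    norm_sq_orthogonalProjectionOnto_of_eq_sup hUV (hsum i),
    norm_sq_orthogonalProjectionOnto_of_eq_sup hUV (hsum i), hU, hV]
end

section
/- Let {W_i}_{i=1}^M be subspaces of ℝ^N which do norm retrieval, and suppose that for each i ∈ [M], W_i = U_i ⊕ V_i is an orthogonal direct sum of subspaces U_i and V_i (so U_i ⊥ V_i and W_i = U_i + V_i). Then the family of 2M subspaces {U_1, …, U_M, V_1, …, V_M} does norm retrieval in ℝ^N. -/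
open Submodule
open scoped RealInnerProductSpace

/-- Pythagoras for the orthogonal projection onto an orthogonal sum of two subspaces. -/
theorem norm_sq_orthogonalProjectionOnto_sup {E : Type*} [NormedAddCommGroup E]
    [InnerProductSpace ℝ E] {U V : Submodule ℝ E} [U.HasOrthogonalProjection]
    [V.HasOrthogonalProjection] [(U ⊔ V).HasOrthogonalProjection]
    (h : ∀ u ∈ U, ∀ v ∈ V, ⟪u, v⟫ = 0) (x : E) :
    ‖orthogonalProjectionOnto (U ⊔ V) x‖ ^ 2 =
      ‖orthogonalProjectionOnto U x‖ ^ 2 + ‖orthogonalProjectionOnto V x‖ ^ 2 := by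
  have hproj : (U ⊔ V).starProjection x = U.starProjection x + V.starProjection x := by
    refine (eq_starProjection_of_mem_orthogonal
      (add_mem_sup (starProjection_apply_mem U x) (starProjection_apply_mem V x)) ?_)
    rw [← inf_orthogonal, mem_inf]
    constructor
    · rw [← sub_sub]
      refine sub_mem (sub_starProjection_mem_orthogonal x) ?_
      exact (mem_orthogonal _ _).2 fun u hu => h u hu _ (starProjection_apply_mem V x)
    · rw [add_comm, ← sub_sub]
      refine sub_mem (sub_starProjection_mem_orthogonal x) ?_
      exact (mem_orthogonal' _ _).2 fun v hv => h _ (starProjection_apply_mem U x) v hv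
  simp only [Submodule.coe_norm, coe_orthogonalProjectionOnto_apply, hproj]
  simpa only [sq] using norm_add_sq_eq_norm_sq_add_norm_sq_real
    (h _ (starProjection_apply_mem U x) _ (starProjection_apply_mem V x))

/-- If subspaces `{W i}` of `ℝ^N` do norm retrieval and each `W i` is the orthogonal
direct sum of subspaces `U i` and `V i`, then the family `{U i} ∪ {V i}` also does norm
retrieval. -/
theorem stmt_14 (N M : ℕ)
    (W U V : Fin M → Submodule ℝ (EuclideanSpace ℝ (Fin N)))
    (horth : ∀ i, ∀ u ∈ U i, ∀ v ∈ V i, ⟪u, v⟫ = 0)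
    (hsum : ∀ i, W i = U i ⊔ V i)
    (hNR : ∀ x y : EuclideanSpace ℝ (Fin N),
      (∀ i, ‖orthogonalProjection (W i) x‖ = ‖orthogonalProjection (W i) y‖) →
      ‖x‖ = ‖y‖) :
    ∀ x y : EuclideanSpace ℝ (Fin N),
      (∀ k : Fin M ⊕ Fin M,
        ‖orthogonalProjection (Sum.elim U V k) x‖ = ‖orthogonalProjection (Sum.elim U V k) y‖) →
      ‖x‖ = ‖y‖ := by
  intro x y hxy
  obtain rfl : W = fun i => U i ⊔ V i := funext hsum
  refine hNR x y fun i => (sq_eq_sq₀ (norm_nonneg _) (norm_nonneg _)).1 ?_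
  have hU : ‖orthogonalProjectionOnto (U i) x‖ = ‖orthogonalProjectionOnto (U i) y‖ :=
    hxy (.inl i)
  have hV : ‖orthogonalProjectionOnto (V i) x‖ = ‖orthogonalProjectionOnto (V i) y‖ :=
    hxy (.inr i)
  refine (norm_sq_orthogonalProjectionOnto_sup (horth i) x).trans ?_
  rw [hU, hV]
  exact (norm_sq_orthogonalProjectionOnto_sup (horth i) y).symm
end

section
/- Let W_1 and W_2 be proper subspaces of ℝ^N (i.e., W_i ≠ {0} and W_i ≠ ℝ^N). Then the pair {W_1, W_2} does norm retrieval if and only if W_2 = W_1^⊥ (equivalently, W_1 and W_2 are the orthogonal complements of each other). -/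
open Submodule
open scoped RealInnerProductSpace

section

variable {E : Type*} [NormedAddCommGroup E] [InnerProductSpace ℝ E]

theorem norm_add_eq_norm_sub_of_inner_eq_zero {u v : E} (h : ⟪u, v⟫ = 0) :
    ‖u + v‖ = ‖u - v‖ := by
  rw [← sq_eq_sq₀ (norm_nonneg _) (norm_nonneg _), norm_add_sq_real, norm_sub_sq_real, h]
  ring

theorem inner_eq_zero_of_norm_add_eq_norm_sub {u v : E} (h : ‖u + v‖ = ‖u - v‖) :
    ⟪u, v⟫ = 0 := by
  have h' := congrArg (· ^ 2) h
  simp only [norm_add_sq_real, norm_sub_sq_real] at h'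
  linarith

variable {U W : Submodule ℝ E} [U.HasOrthogonalProjection]

theorem eq_orthogonal_of_disjoint_of_orthogonal_le (hd : Disjoint U W) (hle : Uᗮ ≤ W) :
    W = Uᗮ := by
  refine le_antisymm (fun x hx => ?_) hle
  have hv : x - U.orthogonalProjectionOnto x ∈ Uᗮ := U.sub_starProjection_mem_orthogonal x
  have hPx : (U.orthogonalProjectionOnto x : E) ∈ W := by
    simpa using W.sub_mem hx (hle hv)
  have h0 := disjoint_def.1 hd _ (U.orthogonalProjectionOnto x).2 hPx
  rwa [h0, sub_zero] at hv

variable [W.HasOrthogonalProjection]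

theorem inner_eq_zero_of_normRetrieval
    (H : ∀ x y : E, ‖U.orthogonalProjectionOnto x‖ = ‖U.orthogonalProjectionOnto y‖ →
      ‖W.orthogonalProjectionOnto x‖ = ‖W.orthogonalProjectionOnto y‖ → ‖x‖ = ‖y‖)
    {u v : E} (hU : ⟪U.orthogonalProjectionOnto u, U.orthogonalProjectionOnto v⟫ = 0)
    (hW : ⟪W.orthogonalProjectionOnto u, W.orthogonalProjectionOnto v⟫ = 0) : ⟪u, v⟫ = 0 := by
  apply inner_eq_zero_of_norm_add_eq_norm_sub
  apply H
  · simpa only [map_add, map_sub] using norm_add_eq_norm_sub_of_inner_eq_zero hU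
  · simpa only [map_add, map_sub] using norm_add_eq_norm_sub_of_inner_eq_zero hW

theorem orthogonal_le_of_normRetrieval
    (H : ∀ x y : E, ‖U.orthogonalProjectionOnto x‖ = ‖U.orthogonalProjectionOnto y‖ →
      ‖W.orthogonalProjectionOnto x‖ = ‖W.orthogonalProjectionOnto y‖ → ‖x‖ = ‖y‖) :
    Uᗮ ≤ W := by
  intro u hu
  have hv : u - W.orthogonalProjectionOnto u ∈ Wᗮ := W.sub_starProjection_mem_orthogonal u
  have hPu : U.orthogonalProjectionOnto u = 0 := orthogonalProjectionOnto_eq_zero_iff.2 hu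
  have hPv : W.orthogonalProjectionOnto (u - W.orthogonalProjectionOnto u) = 0 :=
    orthogonalProjectionOnto_eq_zero_iff.2 hv
  have h : ⟪u, u - W.orthogonalProjectionOnto u⟫ = 0 :=
    inner_eq_zero_of_normRetrieval H (by rw [hPu, inner_zero_left]) (by rw [hPv, inner_zero_right])
  have h' : ⟪(W.orthogonalProjectionOnto u : E), u - W.orthogonalProjectionOnto u⟫ = 0 :=
    inner_right_of_mem_orthogonal (W.orthogonalProjectionOnto u).2 hv
  have h0 : u - W.orthogonalProjectionOnto u = 0 := by
    rw [← inner_self_eq_zero (𝕜 := ℝ), inner_sub_left, h, h', sub_zero]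
  rw [sub_eq_zero.1 h0]
  exact (W.orthogonalProjectionOnto u).2

theorem disjoint_of_normRetrieval
    (H : ∀ x y : E, ‖U.orthogonalProjectionOnto x‖ = ‖U.orthogonalProjectionOnto y‖ →
      ‖W.orthogonalProjectionOnto x‖ = ‖W.orthogonalProjectionOnto y‖ → ‖x‖ = ‖y‖)
    (hU : U ≠ ⊤) (hW : W ≠ ⊤) : Disjoint U W := by
  rw [disjoint_def]
  intro w hwU hwW
  by_contra hw
  obtain ⟨a, ha, ha0⟩ := Uᗮ.exists_mem_ne_zero_of_ne_bot (by rwa [Ne, orthogonal_eq_bot_iff])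
  obtain ⟨b, hb, hb0⟩ := Wᗮ.exists_mem_ne_zero_of_ne_bot (by rwa [Ne, orthogonal_eq_bot_iff])
  have haW : a ∈ W := orthogonal_le_of_normRetrieval H ha
  have hbU : b ∈ U := orthogonal_le_of_normRetrieval (fun x y h h' => H x y h' h) hb
  have hab : ⟪a, b⟫ = 0 := inner_right_of_mem_orthogonal haW hb
  have haw : ⟪a, w⟫ = 0 := inner_left_of_mem_orthogonal hwU ha
  have hbw : ⟪b, w⟫ = 0 := inner_left_of_mem_orthogonal hwW hb
  have hba : ⟪b, a⟫ = 0 := by rw [real_inner_comm, hab]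
  have hwa : ⟪w, a⟫ = 0 := by rw [real_inner_comm, haw]
  have hwb : ⟪w, b⟫ = 0 := by rw [real_inner_comm, hbw]
  have hPU : ∀ p q r : ℝ, (U.orthogonalProjectionOnto (p • a + q • b + r • w) : E) =
      q • b + r • w := by
    intro p q r
    have h₁ : U.orthogonalProjectionOnto a = 0 := orthogonalProjectionOnto_eq_zero_iff.2 ha
    have h₂ := U.starProjection_eq_self_iff.2 (U.add_mem (U.smul_mem q hbU) (U.smul_mem r hwU))
    rw [add_assoc, map_add, map_smul, h₁, smul_zero, zero_add]
    exact h₂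
  have hPW : ∀ p q r : ℝ, (W.orthogonalProjectionOnto (p • a + q • b + r • w) : E) =
      p • a + r • w := by
    intro p q r
    have h₁ : W.orthogonalProjectionOnto b = 0 := orthogonalProjectionOnto_eq_zero_iff.2 hb
    have h₂ := W.starProjection_eq_self_iff.2 (W.add_mem (W.smul_mem p haW) (W.smul_mem r hwW))
    rw [add_right_comm, map_add, map_smul W.orthogonalProjectionOnto q, h₁, smul_zero, add_zero]
    exact h₂
  have ha' := inner_self_ne_zero (𝕜 := ℝ).2 ha0
  have hb' := inner_self_ne_zero (𝕜 := ℝ).2 hb0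
  have hw' := inner_self_ne_zero (𝕜 := ℝ).2 hw
  have key : ⟪(1 : ℝ) • a + (1 : ℝ) • b + (1 : ℝ) • w,
      (-⟪a, a⟫⁻¹) • a + (-⟪b, b⟫⁻¹) • b + ⟪w, w⟫⁻¹ • w⟫ = 0 := by
    apply inner_eq_zero_of_normRetrieval H
    · rw [coe_inner, hPU, hPU]
      simp only [inner_add_left, inner_add_right, inner_smul_left_eq_smul,
        inner_smul_right_eq_smul, hbw, hwb, smul_eq_mul]
      field_simp
      ring
    · rw [coe_inner, hPW, hPW]
      simp only [inner_add_left, inner_add_right, inner_smul_left_eq_smul,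
        inner_smul_right_eq_smul, haw, hwa, smul_eq_mul]
      field_simp
      ring
  simp only [inner_add_left, inner_add_right, inner_smul_left_eq_smul,
    inner_smul_right_eq_smul, haw, hwa, hbw, hwb, hab, hba, smul_eq_mul, neg_mul,
    inv_mul_cancel₀ ha', inv_mul_cancel₀ hb', inv_mul_cancel₀ hw', mul_zero, add_zero, zero_add,
    one_mul] at key
  norm_num at key

end

/-- Two proper subspaces of `ℝ^N` do norm retrieval if and only if they are orthogonal
complements of each other. -/
theorem stmt_15 (N : ℕ) (W₁ W₂ : Submodule ℝ (EuclideanSpace ℝ (Fin N)))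
    (h1 : W₁ ≠ ⊥) (h1' : W₁ ≠ ⊤) (h2 : W₂ ≠ ⊥) (h2' : W₂ ≠ ⊤) :
    (∀ x y : EuclideanSpace ℝ (Fin N),
      ‖orthogonalProjection W₁ x‖ = ‖orthogonalProjection W₁ y‖ →
      ‖orthogonalProjection W₂ x‖ = ‖orthogonalProjection W₂ y‖ →
      ‖x‖ = ‖y‖)
    ↔ W₂ = W₁ᗮ := by
  constructor
  · intro H
    exact eq_orthogonal_of_disjoint_of_orthogonal_le (disjoint_of_normRetrieval H h1' h2')
      (orthogonal_le_of_normRetrieval H)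
  · rintro rfl x y hx hy
    rw [← sq_eq_sq₀ (norm_nonneg _) (norm_nonneg _), norm_sq_eq_add_norm_sq_projection x W₁,
      norm_sq_eq_add_norm_sq_projection y W₁, hx, hy]
end
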